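/- Suppose the DFP initialization satisfies ‖x_0 − x_*‖ ≤ μ^{3/2}/(200·M·√L) and ‖B̂_0 − I‖_F ≤ 1/12. Then for every k ≥ 1 the DFP iterates satisfy ‖x_k − x_*‖ ≤ √(L/μ)·(1/k)^{k/2}·‖x_0 − x_*‖. -/

import Mathlib

noncomputable section

open Matrix Finset

abbrev E (d : ℕ) := EuclideanSpace ℝ (Fin d)
abbrev Mat (d : ℕ) := Matrix (Fin d) (Fin d) ℝ

/-- Spectral (operator 2-) norm of a real matrix. -/
def spec {d : ℕ} (A : Mat d) : ℝ := ‖Matrix.toEuclideanCLM (𝕜 := ℝ) A‖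

/-- Frobenius norm of a real matrix. -/
def frob {d : ℕ} (A : Mat d) : ℝ := Real.sqrt (∑ i, ∑ j, (A i j) ^ 2)

/-- A matrix acting on a Euclidean vector. -/
def mApp {d : ℕ} (A : Mat d) (v : E d) : E d := Matrix.toEuclideanCLM (𝕜 := ℝ) A v

/-- Outer product `u vᵀ`. -/
def outer {d : ℕ} (u v : E d) : Mat d := Matrix.of fun i j => u i * v j

/-- Euclidean dot product. -/
def dot {d : ℕ} (u v : E d) : ℝ := ∑ i, u i * v i

/-- `σ(x) = (M/μ^{3/2})·‖H_*^{1/2}(x − x_*)‖`. -/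
def sig {d : ℕ} (M μ : ℝ) (sqH : Mat d) (xs x : E d) : ℝ :=
  M / μ ^ ((3:ℝ)/2) * ‖mApp sqH (x - xs)‖

/-- The DFP update of the Hessian approximation. -/
def dfpUpdate {d : ℕ} (B : Mat d) (s y : E d) : Mat d :=
  (1 - (dot y s)⁻¹ • outer y s) * B * (1 - (dot s y)⁻¹ • outer s y)
    + (dot y s)⁻¹ • outer y y

section DFP

variable {d : ℕ}

lemma mApp_apply (A : Mat d) (v : E d) (i : Fin d) : mApp A v i = ∑ j, A i j * v j := by
  simp [mApp, Matrix.mulVec, dotProduct]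

lemma mApp_mul (A B : Mat d) (v : E d) : mApp (A * B) v = mApp A (mApp B v) := by
  simp [mApp]

lemma mApp_one (v : E d) : mApp 1 v = v := by
  simp [mApp]

lemma mApp_sub_left (A B : Mat d) (v : E d) : mApp (A - B) v = mApp A v - mApp B v := by
  simp [mApp]

lemma mApp_sub (A : Mat d) (v w : E d) : mApp A (v - w) = mApp A v - mApp A w := by
  simp [mApp]

lemma mApp_smul (A : Mat d) (c : ℝ) (v : E d) : mApp A (c • v) = c • mApp A v := by
  simp [mApp]

lemma dot_self (u : E d) : dot u u = ‖u‖ ^ 2 := by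
  rw [EuclideanSpace.norm_sq_eq]
  simp only [Real.norm_eq_abs, sq_abs]
  simp [dot, sq]

lemma dot_eq_inner (u v : E d) : dot u v = inner ℝ u v := by
  simp [dot, PiLp.inner_apply, mul_comm]

lemma dot_comm (u v : E d) : dot u v = dot v u := by
  simp [dot, mul_comm]

lemma abs_dot_le (u v : E d) : |dot u v| ≤ ‖u‖ * ‖v‖ := by
  rw [dot_eq_inner]; exact abs_real_inner_le_norm u v

lemma dot_mApp (A : Mat d) (u v : E d) : dot u (mApp A v) = dot (mApp Aᵀ u) v := by
  simp only [dot, mApp_apply, mul_sum, sum_mul, transpose_apply]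
  rw [sum_comm]
  exact sum_congr rfl fun _ _ => sum_congr rfl fun _ _ => by ring

lemma mul_outer (A : Mat d) (u v : E d) : A * outer u v = outer (mApp A u) v := by
  ext i j
  simp [Matrix.mul_apply, outer, mApp_apply, sum_mul, mul_assoc]

lemma outer_mul (A : Mat d) (u v : E d) : outer u v * A = outer u (mApp Aᵀ v) := by
  ext i j
  simp only [Matrix.mul_apply, outer, mApp_apply, mul_sum, of_apply, transpose_apply]
  exact sum_congr rfl fun _ _ => by ring

lemma mApp_outer (u v w : E d) : mApp (outer u v) w = dot v w • u := by
  ext i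
  simp only [mApp_apply, outer, of_apply, dot, PiLp.smul_apply, smul_eq_mul, sum_mul]
  exact sum_congr rfl fun _ _ => by ring

lemma frob_nonneg (A : Mat d) : 0 ≤ frob A := Real.sqrt_nonneg _

lemma frob_sq (A : Mat d) : frob A ^ 2 = ∑ i, ∑ j, (A i j) ^ 2 :=
  Real.sq_sqrt (sum_nonneg fun _ _ => sum_nonneg fun _ _ => sq_nonneg _)

lemma frob_transpose (A : Mat d) : frob Aᵀ = frob A := by
  simp only [frob, transpose_apply]
  rw [sum_comm]

section Frobenius

attribute [local instance] Matrix.frobeniusNormedAddCommGroup Matrix.frobeniusNormedSpace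

lemma frob_eq_norm (A : Mat d) : frob A = ‖A‖ := by
  rw [Matrix.frobenius_norm_def, frob, Real.sqrt_eq_rpow]
  simp

lemma frob_add_le (A B : Mat d) : frob (A + B) ≤ frob A + frob B := by
  simpa only [frob_eq_norm] using norm_add_le A B

lemma frob_sub_le (A B : Mat d) : frob (A - B) ≤ frob A + frob B := by
  simpa only [frob_eq_norm] using norm_sub_le A B

lemma frob_smul (c : ℝ) (A : Mat d) : frob (c • A) = |c| * frob A := by
  simpa only [frob_eq_norm, Real.norm_eq_abs] using norm_smul c A

end Frobenius

lemma frob_outer (u v : E d) : frob (outer u v) = ‖u‖ * ‖v‖ := by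
  rw [← sq_eq_sq₀ (frob_nonneg _) (by positivity), frob_sq, mul_pow,
    EuclideanSpace.norm_sq_eq, EuclideanSpace.norm_sq_eq, sum_mul_sum]
  simp [outer, mul_pow]

lemma norm_mApp_le (A : Mat d) (v : E d) : ‖mApp A v‖ ≤ frob A * ‖v‖ := by
  rw [← sq_le_sq₀ (norm_nonneg _) (by have := frob_nonneg A; positivity), mul_pow, frob_sq,
    EuclideanSpace.norm_sq_eq, EuclideanSpace.norm_sq_eq, sum_mul]
  refine sum_le_sum fun i _ => ?_
  simpa [mApp_apply] using sum_mul_sq_le_sq_mul_sq univ (A i) v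

lemma frob_sq_sub_outer (A : Mat d) {u : E d} (hu : ‖u‖ = 1) :
    frob (A - outer (mApp A u) u) ^ 2 = frob A ^ 2 - ‖mApp A u‖ ^ 2 := by
  have hu2 : ∑ j, u j ^ 2 = 1 := by
    have := EuclideanSpace.norm_sq_eq u
    simpa [hu] using this.symm
  rw [frob_sq, frob_sq, EuclideanSpace.norm_sq_eq, ← sum_sub_distrib]
  refine sum_congr rfl fun i _ => ?_
  have h : mApp A u i = ∑ j, A i j * u j := mApp_apply A u i
  generalize hw : mApp A u i = w at h ⊢
  calc ∑ j, (A - outer (mApp A u) u) i j ^ 2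
      = ∑ j, (A i j ^ 2 - 2 * w * (A i j * u j) + w ^ 2 * u j ^ 2) := by
        refine sum_congr rfl fun j _ => ?_
        simp only [Matrix.sub_apply, outer, of_apply, hw]
        ring
    _ = _ := by
        rw [sum_add_distrib, sum_sub_distrib, ← mul_sum, ← mul_sum, hu2, ← h]
        simp only [Real.norm_eq_abs, sq_abs]; ring

lemma frob_sub_outer_transpose_le (A : Mat d) {u : E d} (hu : ‖u‖ = 1) :
    frob (A - outer u (mApp Aᵀ u)) ≤ frob A := by
  have h : (A - outer u (mApp Aᵀ u))ᵀ = Aᵀ - outer (mApp Aᵀ u) u := by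
    ext i j; simp [outer, mul_comm]
  rw [← frob_transpose, h, ← frob_transpose A, ← sq_le_sq₀ (frob_nonneg _) (frob_nonneg _),
    frob_sq_sub_outer _ hu]
  nlinarith [sq_nonneg ‖mApp Aᵀ u‖]

lemma dfpUpdate_conj {S : Mat d} (hS : Sᵀ = S) (hu : IsUnit S) (B : Mat d) (s y : E d) :
    S⁻¹ * dfpUpdate B s y * S⁻¹ = dfpUpdate (S⁻¹ * B * S⁻¹) (mApp S s) (mApp S⁻¹ y) := by
  have hdet : IsUnit S.det := (Matrix.isUnit_iff_isUnit_det S).1 hu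
  have hSi : (S⁻¹)ᵀ = S⁻¹ := by rw [Matrix.transpose_nonsing_inv, hS]
  have h1 : S⁻¹ * S = 1 := Matrix.nonsing_inv_mul S hdet
  have h2 : S * S⁻¹ = 1 := Matrix.mul_nonsing_inv S hdet
  have hdot : dot (mApp S⁻¹ y) (mApp S s) = dot y s := by
    rw [dot_mApp, hS, ← mApp_mul, h2, mApp_one]
  have hdot' : dot (mApp S s) (mApp S⁻¹ y) = dot s y := by
    rw [dot_comm, hdot, dot_comm]
  have hyy : outer (mApp S⁻¹ y) (mApp S⁻¹ y) = S⁻¹ * outer y y * S⁻¹ := by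
    rw [mul_outer, outer_mul, hSi]
  have hys : outer (mApp S⁻¹ y) (mApp S s) = S⁻¹ * outer y s * S := by
    rw [mul_outer, outer_mul, hS]
  have hsy : outer (mApp S s) (mApp S⁻¹ y) = S * outer s y * S⁻¹ := by
    rw [mul_outer, outer_mul, hSi]
  have hl : 1 - (dot y s)⁻¹ • (S⁻¹ * outer y s * S) = S⁻¹ * (1 - (dot y s)⁻¹ • outer y s) * S := by
    simp [mul_sub, sub_mul, h1]
  have hr : 1 - (dot s y)⁻¹ • (S * outer s y * S⁻¹) = S * (1 - (dot s y)⁻¹ • outer s y) * S⁻¹ := by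
    simp [mul_sub, sub_mul, h2]
  unfold dfpUpdate
  rw [hdot, hdot', hyy, hys, hsy, hl, hr]
  generalize 1 - (dot y s)⁻¹ • outer y s = P
  generalize 1 - (dot s y)⁻¹ • outer s y = Q
  have h3 : S⁻¹ * P * S * (S⁻¹ * B * S⁻¹) * (S * Q * S⁻¹) =
      S⁻¹ * P * (S * S⁻¹) * B * (S⁻¹ * S) * Q * S⁻¹ := by noncomm_ring
  rw [h3, h1, h2]
  simp [mul_add, add_mul, mul_assoc]

lemma rank_one_update_sub_one (B : Mat d) (u p : E d) (a : ℝ) (hu : dot u u = 1) :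
    (1 - outer (u + p) u) * B * (1 - outer u (u + p)) + a • outer (u + p) (u + p) - 1 =
      (((B - 1) - outer (mApp (B - 1) u) u)
          - outer u (mApp ((B - 1) - outer (mApp (B - 1) u) u)ᵀ u))
        - outer p (mApp ((B - 1) - outer (mApp (B - 1) u) u)ᵀ u)
        - outer (mApp (B - 1) u - dot u (mApp (B - 1) u) • (u + p)) p
        + ((a - 1) • outer u u + a • outer p u + a • outer u p + (1 + a) • outer p p) := by
  obtain ⟨A, rfl⟩ : ∃ A, B = 1 + A := ⟨B - 1, by abel⟩
  rw [add_sub_cancel_left]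
  have ht : mApp (A - outer (mApp A u) u)ᵀ u = mApp Aᵀ u - dot u (mApp A u) • u := by
    have h : (A - outer (mApp A u) u)ᵀ = Aᵀ - outer u (mApp A u) := by
      ext i j; simp [outer, mul_comm]
    rw [h, mApp_sub_left, mApp_outer, dot_comm]
  have hco : outer (u + p) u * outer u (u + p) = outer (u + p) (u + p) := by
    rw [mul_outer, mApp_outer, hu, one_smul]
  have h1 : outer (u + p) u * A = outer (u + p) (mApp Aᵀ u) := outer_mul _ _ _
  have h2 : A * outer u (u + p) = outer (mApp A u) (u + p) := mul_outer _ _ _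
  have h3 : outer (u + p) u * A * outer u (u + p) = dot u (mApp A u) • outer (u + p) (u + p) := by
    rw [mul_assoc, h2, mul_outer, mApp_outer]
    ext i j; simp [outer]; ring
  have hexp : (1 - outer (u + p) u) * (1 + A) * (1 - outer u (u + p)) =
      1 - outer (u + p) u - outer u (u + p) + outer (u + p) u * outer u (u + p)
      + A - outer (u + p) u * A - A * outer u (u + p)
      + outer (u + p) u * A * outer u (u + p) := by noncomm_ring
  rw [hexp, h3, hco, h1, h2, ht]
  ext i j
  simp only [outer, Matrix.add_apply, Matrix.sub_apply, Matrix.smul_apply, of_apply,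
    PiLp.add_apply, PiLp.sub_apply, PiLp.smul_apply, smul_eq_mul]
  ring

lemma frob_rank_one_update_sub_one_le (B : Mat d) {u p : E d} {a τ : ℝ} (hu : ‖u‖ = 1)
    (hB : frob (B - 1) ≤ 1 / 6) (hτ : τ ≤ 1 / 200) (ha : |a - 1| ≤ τ) (hp : a * ‖p‖ ≤ τ) :
    frob ((1 - outer (u + p) u) * B * (1 - outer u (u + p))
        + a • outer (u + p) (u + p) - 1)
      ≤ frob (B - 1) - 3 * ‖mApp (B - 1) u‖ ^ 2 + 4 * τ := by
  have huu : dot u u = 1 := by rw [dot_self, hu, one_pow]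
  rw [rank_one_update_sub_one B u p a huu]
  generalize B - 1 = A at *
  set F := A - outer (mApp A u) u with hF
  have hFsq : frob F ^ 2 = frob A ^ 2 - ‖mApp A u‖ ^ 2 := frob_sq_sub_outer A hu
  have hq : ‖mApp A u‖ ≤ frob A := by simpa [hu] using norm_mApp_le A u
  have hq0 := norm_nonneg (mApp A u)
  have he0 := frob_nonneg A
  have hF0 := frob_nonneg F
  generalize hqq : ‖mApp A u‖ = q at *
  generalize frob A = e at *
  have hFe : frob F ≤ e := by nlinarith
  have hFle : frob F ≤ e - 3 * q ^ 2 := by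
    have h0 : 0 ≤ e - 3 * q ^ 2 := by nlinarith
    rw [← sq_le_sq₀ hF0 h0, hFsq]
    nlinarith [sq_nonneg q, sq_nonneg (q ^ 2), mul_nonneg (sq_nonneg q) (sub_nonneg.2 hB)]
  have hFt : ‖mApp Fᵀ u‖ ≤ e := by
    have := norm_mApp_le Fᵀ u
    rw [frob_transpose, hu, mul_one] at this
    exact this.trans hFe
  have hτ0 : 0 ≤ τ := (abs_nonneg _).trans ha
  obtain ⟨ha1, ha2⟩ := abs_le.1 ha
  have hp0 := norm_nonneg p
  have hpτ : ‖p‖ ≤ 200 / 199 * τ := by nlinarith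
  have hd : |dot u (mApp A u)| ≤ q := by simpa [hu, hqq] using abs_dot_le u (mApp A u)
  have hup : ‖u + p‖ ≤ 1 + ‖p‖ := (norm_add_le _ _).trans (by rw [hu])
  have hG : ‖mApp A u - dot u (mApp A u) • (u + p)‖ ≤ q + q * (1 + ‖p‖) := by
    refine (norm_sub_le _ _).trans ?_
    rw [hqq, norm_smul, Real.norm_eq_abs]
    gcongr
  have b1 : frob (F - outer u (mApp Fᵀ u)) ≤ e - 3 * q ^ 2 :=
    (frob_sub_outer_transpose_le F hu).trans hFle
  have b2 : frob (outer p (mApp Fᵀ u)) ≤ ‖p‖ * e := by rw [frob_outer]; gcongr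
  have b3 : frob (outer (mApp A u - dot u (mApp A u) • (u + p)) p)
      ≤ (q + q * (1 + ‖p‖)) * ‖p‖ := by rw [frob_outer]; gcongr
  have b4 : frob ((a - 1) • outer u u) ≤ τ := by
    rw [frob_smul, frob_outer, hu]; simpa using ha
  have b5 : frob (a • outer p u) ≤ τ := by
    rw [frob_smul, frob_outer, hu, abs_of_nonneg (by linarith)]; simpa using hp
  have b6 : frob (a • outer u p) ≤ τ := by
    rw [frob_smul, frob_outer, hu, abs_of_nonneg (by linarith)]; simpa using hp
  have b7 : frob ((1 + a) • outer p p) ≤ (1 + a) * (‖p‖ * ‖p‖) := by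
    rw [frob_smul, frob_outer, abs_of_nonneg (by linarith)]
  have t := frob_add_le (F - outer u (mApp Fᵀ u) - outer p (mApp Fᵀ u)
      - outer (mApp A u - dot u (mApp A u) • (u + p)) p)
      ((a - 1) • outer u u + a • outer p u + a • outer u p + (1 + a) • outer p p)
  have t1 := frob_sub_le (F - outer u (mApp Fᵀ u) - outer p (mApp Fᵀ u))
      (outer (mApp A u - dot u (mApp A u) • (u + p)) p)
  have t2 := frob_sub_le (F - outer u (mApp Fᵀ u)) (outer p (mApp Fᵀ u))
  have t3 := frob_add_le ((a - 1) • outer u u + a • outer p u + a • outer u p)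
      ((1 + a) • outer p p)
  have t4 := frob_add_le ((a - 1) • outer u u + a • outer p u) (a • outer u p)
  have t5 := frob_add_le ((a - 1) • outer u u) (a • outer p u)
  have c1 : ‖p‖ * e ≤ 200 / 199 * τ * (1 / 6) := by gcongr
  have c2 : (q + q * (1 + ‖p‖)) * ‖p‖ ≤ (1 / 6 + 1 / 6 * (1 + 1 / 100)) * (200 / 199 * τ) := by
    have : ‖p‖ ≤ 1 / 100 := by linarith
    have : q ≤ 1 / 6 := hq.trans hB
    gcongr
  have c3 : (1 + a) * (‖p‖ * ‖p‖) ≤ 3 * (1 / 100 * (200 / 199 * τ)) := by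
    have : ‖p‖ ≤ 1 / 100 := by linarith
    have : 1 + a ≤ 3 := by linarith
    gcongr
  linarith

lemma dfpUpdate_eq_rank_one {B : Mat d} {s y : E d} (hs : s ≠ 0) (hy : dot y s ≠ 0) :
    dfpUpdate B s y =
      (1 - outer ((‖s‖ / dot y s) • y) (‖s‖⁻¹ • s)) * B *
          (1 - outer (‖s‖⁻¹ • s) ((‖s‖ / dot y s) • y))
        + (dot y s / ‖s‖ ^ 2) • outer ((‖s‖ / dot y s) • y) ((‖s‖ / dot y s) • y) := by
  have hs' : ‖s‖ ≠ 0 := norm_ne_zero_iff.2 hs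
  have h1 : outer ((‖s‖ / dot y s) • y) (‖s‖⁻¹ • s) = (dot y s)⁻¹ • outer y s := by
    ext i j; simp [outer]; field_simp
  have h2 : outer (‖s‖⁻¹ • s) ((‖s‖ / dot y s) • y) = (dot s y)⁻¹ • outer s y := by
    rw [dot_comm s y]
    ext i j; simp [outer]; field_simp
  have h3 : (dot y s / ‖s‖ ^ 2) • outer ((‖s‖ / dot y s) • y) ((‖s‖ / dot y s) • y)
      = (dot y s)⁻¹ • outer y y := by
    ext i j; simp [outer]; field_simp
  rw [h1, h2, h3, dfpUpdate]

lemma frob_dfpUpdate_sub_one_le {B : Mat d} {s y : E d} {τ : ℝ} (hs : s ≠ 0)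
    (hB : frob (B - 1) ≤ 1 / 6) (hτ : τ ≤ 1 / 200) (hy : ‖y - s‖ ≤ τ * ‖s‖) :
    frob (dfpUpdate B s y - 1)
      ≤ frob (B - 1) - 3 * (‖mApp (B - 1) s‖ / ‖s‖) ^ 2 + 4 * τ := by
  have hs0 : 0 < ‖s‖ := norm_pos_iff.2 hs
  have hss : dot s s = ‖s‖ ^ 2 := dot_self s
  have hdys : dot y s = dot (y - s) s + ‖s‖ ^ 2 := by
    rw [← hss, dot_eq_inner, dot_eq_inner, dot_eq_inner, inner_sub_left]; ring
  have hda : |dot (y - s) s| ≤ τ * ‖s‖ ^ 2 :=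
    (abs_dot_le _ _).trans (by nlinarith)
  obtain ⟨hd1, hd2⟩ := abs_le.1 hda
  have hs2 : 0 < ‖s‖ ^ 2 := by positivity
  have hpos : 0 < dot y s := by nlinarith
  set u : E d := ‖s‖⁻¹ • s with hu
  have hun : ‖u‖ = 1 := by rw [hu, norm_smul, norm_inv, norm_norm]; field_simp
  set p : E d := (‖s‖ / dot y s) • y - u with hp
  set a : ℝ := dot y s / ‖s‖ ^ 2 with ha
  have ha1 : |a - 1| ≤ τ := by
    have : a - 1 = dot (y - s) s / ‖s‖ ^ 2 := by rw [ha, hdys]; field_simp; ring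
    rw [this, abs_div, abs_of_pos hs2, div_le_iff₀ hs2]; exact hda
  have ha0 : 0 < a := by positivity
  have hap : a * ‖p‖ ≤ τ := by
    have e1 : a * ‖p‖ = ‖a • p‖ := by rw [norm_smul, Real.norm_eq_abs, abs_of_pos ha0]
    have e2 : a • p = ‖s‖⁻¹ • (y - s) - (a - 1) • u := by
      rw [hp, smul_sub, smul_smul, sub_smul, one_smul, smul_sub, ← hu]
      have : a * (‖s‖ / dot y s) = ‖s‖⁻¹ := by rw [ha]; field_simp
      rw [this]; abel
    have e3 : inner ℝ (‖s‖⁻¹ • (y - s)) u = a - 1 := by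
      rw [hu, inner_smul_left, inner_smul_right, ← dot_eq_inner, ha, hdys]
      simp; field_simp; ring
    have e4 : ‖a • p‖ ^ 2 ≤ ‖‖s‖⁻¹ • (y - s)‖ ^ 2 := by
      rw [e2, norm_sub_sq_real, inner_smul_right, e3, norm_smul (a - 1), hun, mul_pow,
        Real.norm_eq_abs, sq_abs]
      nlinarith [sq_nonneg (a - 1)]
    have e5 : ‖‖s‖⁻¹ • (y - s)‖ ≤ τ := by
      rw [norm_smul, norm_inv, norm_norm, inv_mul_le_iff₀ hs0]; linarith
    rw [e1]
    exact ((sq_le_sq₀ (norm_nonneg _) (norm_nonneg _)).1 e4).trans e5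
  have key := frob_rank_one_update_sub_one_le B hun hB hτ ha1 hap
  have hc : u + p = (‖s‖ / dot y s) • y := by rw [hp]; abel
  have hn : ‖mApp (B - 1) u‖ = ‖mApp (B - 1) s‖ / ‖s‖ := by
    rw [hu, mApp_smul, norm_smul, norm_inv, norm_norm]; field_simp
  rw [hc, hn] at key
  rw [dfpUpdate_eq_rank_one hs hpos.ne']
  exact key

/-- One step of the method in the coordinates that turn the Hessian at the minimizer into the
identity, with errors `r` and gradients `w`. -/
lemma normalized_step {B : Mat d} {r r' w w' : E d} {σ : ℝ} (hs : r' - r ≠ 0)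
    (hB : frob (B - 1) ≤ 1 / 6) (hσ0 : 0 ≤ σ) (hσ : σ ≤ 1 / 200)
    (hstep : mApp B (r' - r) = -w) (hw : ‖w - r‖ ≤ σ * ‖r‖)
    (hw' : ‖r'‖ ≤ ‖r‖ → ‖w' - r'‖ ≤ σ * ‖r'‖)
    (hy : ‖r'‖ ≤ ‖r‖ → ‖(w' - w) - (r' - r)‖ ≤ σ * ‖r' - r‖) :
    ‖r'‖ ≤ ‖r‖ / 4 ∧ ∃ q : ℝ,
      frob (dfpUpdate B (r' - r) (w' - w) - 1) ≤ frob (B - 1) - 3 * q ^ 2 + 4 * σ ∧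
      ‖r'‖ ^ 2 ≤ 4 * (q ^ 2 + σ ^ 2) * ‖r‖ ^ 2 := by
  have hlin : ‖r'‖ ≤ ‖r‖ / 4 := by
    have h : r' = mApp (B - 1) r + (r - w) - mApp (B - 1) r' := by
      rw [mApp_sub] at hstep
      rw [mApp_sub_left, mApp_sub_left, mApp_one, mApp_one]
      have : mApp B r' = mApp B r - w := by rw [sub_eq_iff_eq_add.1 hstep]; abel
      rw [this]; abel
    have h1 : ‖r'‖ ≤ ‖mApp (B - 1) r‖ + ‖r - w‖ + ‖mApp (B - 1) r'‖ := by
      calc ‖r'‖ = ‖mApp (B - 1) r + (r - w) - mApp (B - 1) r'‖ := congrArg _ h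
        _ ≤ _ := (norm_sub_le _ _).trans (by gcongr; exact norm_add_le _ _)
    rw [norm_sub_rev r w] at h1
    have h2 := norm_mApp_le (B - 1) r
    have h3 := norm_mApp_le (B - 1) r'
    nlinarith [norm_nonneg r, norm_nonneg r']
  have hle : ‖r'‖ ≤ ‖r‖ := by linarith [norm_nonneg r]
  specialize hw' hle
  specialize hy hle
  have hs0 : 0 < ‖r' - r‖ := norm_pos_iff.2 hs
  refine ⟨hlin, ‖mApp (B - 1) (r' - r)‖ / ‖r' - r‖,
    frob_dfpUpdate_sub_one_le hs hB hσ hy, ?_⟩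
  set q := ‖mApp (B - 1) (r' - r)‖ / ‖r' - r‖ with hq
  have hq0 : 0 ≤ q := by positivity
  have hqs : ‖mApp (B - 1) (r' - r)‖ = q * ‖r' - r‖ := by rw [hq]; field_simp
  have h1 : r' = ((w' - w) - (r' - r)) - mApp (B - 1) (r' - r) - (w' - r') := by
    rw [mApp_sub_left, mApp_one, hstep]; abel
  have h2 : ‖r'‖ ≤ σ * ‖r' - r‖ + q * ‖r' - r‖ + σ * ‖r'‖ := by
    calc ‖r'‖ = ‖((w' - w) - (r' - r)) - mApp (B - 1) (r' - r) - (w' - r')‖ := congrArg _ h1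
      _ ≤ _ := (norm_sub_le _ _).trans <| by
        gcongr
        exact (norm_sub_le _ _).trans <| by gcongr; exact hqs.le
  have h3 : ‖r' - r‖ ≤ 5 / 4 * ‖r‖ := (norm_sub_le _ _).trans (by linarith)
  have h4 : ‖r'‖ ≤ 4 / 3 * ((q + σ) * ‖r‖) := by
    nlinarith [norm_nonneg r, norm_nonneg r']
  calc ‖r'‖ ^ 2 ≤ (4 / 3 * ((q + σ) * ‖r‖)) ^ 2 := by gcongr
    _ = (16 / 9 * (q + σ) ^ 2) * ‖r‖ ^ 2 := by ring
    _ ≤ 4 * (q ^ 2 + σ ^ 2) * ‖r‖ ^ 2 :=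
      mul_le_mul_of_nonneg_right
        (by nlinarith [sq_nonneg (q - σ), sq_nonneg q, sq_nonneg σ]) (sq_nonneg _)

lemma prod_range_le_of_sum_le_one {t : ℕ → ℝ} {k : ℕ} (hk : 1 ≤ k) (ht : ∀ i, 0 ≤ t i)
    (hsum : ∑ i ∈ range k, t i ≤ 1) : ∏ i ∈ range k, t i ≤ (1 / (k : ℝ)) ^ k := by
  have hk0 : (0 : ℝ) < k := by exact_mod_cast hk
  have h := Real.geom_mean_le_arith_mean (range k) (fun _ => (1 : ℝ)) t (by simp)
    (by simpa using hk0) (fun i _ => ht i)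
  simp only [Real.rpow_one, one_mul, sum_const, card_range, nsmul_eq_mul, mul_one] at h
  have hP : 0 ≤ ∏ i ∈ range k, t i := prod_nonneg fun i _ => ht i
  calc ∏ i ∈ range k, t i = ((∏ i ∈ range k, t i) ^ ((k : ℝ)⁻¹)) ^ k :=
        (Real.rpow_inv_natCast_pow hP (by omega)).symm
    _ ≤ (1 / (k : ℝ)) ^ k := by
        gcongr
        exact h.trans (by gcongr)

lemma superlinear_of_step_bounds {e ρ : ℕ → ℝ} {c : ℝ} (hc : 0 ≤ c) (he : ∀ k, 0 ≤ e k)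
    (hρ : ∀ k, 0 ≤ ρ k) (he0 : e 0 ≤ 1 / 12) (hρ0 : c * ρ 0 ≤ 1 / 200)
    (step : ∀ k, e k ≤ 1 / 6 → c * ρ k ≤ 1 / 200 → ρ (k + 1) ≤ ρ k / 4 ∧ ∃ q : ℝ,
      e (k + 1) ≤ e k - 3 * q ^ 2 + 4 * (c * ρ k) ∧
      ρ (k + 1) ^ 2 ≤ 4 * (q ^ 2 + (c * ρ k) ^ 2) * ρ k ^ 2) {k : ℕ} (hk : 1 ≤ k) :
    ρ k ≤ (1 / (k : ℝ)) ^ ((k : ℝ) / 2) * ρ 0 := by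
  set Φ : ℕ → ℝ := fun k => e k + 8 * (c * ρ k) with hΦ
  have hσ0 : ∀ k, 0 ≤ c * ρ k := fun k => mul_nonneg hc (hρ k)
  have hΦ0 : ∀ k, 0 ≤ Φ k := fun k => by have := he k; have := hσ0 k; simp only [hΦ]; linarith
  have main : ∀ k, Φ k ≤ 1 / 6 → c * ρ k ≤ 1 / 200 → Φ (k + 1) ≤ Φ k ∧
      c * ρ (k + 1) ≤ c * ρ k ∧ ρ (k + 1) ^ 2 ≤ 4 / 3 * (Φ k - Φ (k + 1)) * ρ k ^ 2 := by
    intro k h1 h2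
    have hs := hσ0 k
    obtain ⟨h3, q, h4, h5⟩ := step k (by simp only [hΦ] at h1; linarith) h2
    have h6 : c * ρ (k + 1) ≤ c * ρ k / 4 := by
      rw [mul_div_assoc]; exact mul_le_mul_of_nonneg_left h3 hc
    have h7 : 3 * q ^ 2 + 2 * (c * ρ k) ≤ Φ k - Φ (k + 1) := by simp only [hΦ]; linarith
    refine ⟨by linarith [sq_nonneg q], by linarith, h5.trans ?_⟩
    exact mul_le_mul_of_nonneg_right (by nlinarith) (sq_nonneg _)
  have inv : ∀ k, Φ k ≤ 1 / 6 ∧ c * ρ k ≤ 1 / 200 := by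
    intro k
    induction k with
    | zero => exact ⟨by simp only [hΦ]; linarith, hρ0⟩
    | succ k ih =>
      obtain ⟨h1, h2, -⟩ := main k ih.1 ih.2
      exact ⟨h1.trans ih.1, h2.trans ih.2⟩
  set t : ℕ → ℝ := fun i => 4 / 3 * (Φ i - Φ (i + 1)) with ht
  have ht0 : ∀ i, 0 ≤ t i := fun i => by
    have := (main i (inv i).1 (inv i).2).1
    simp only [ht]; linarith
  have hprod : ∀ k, ρ k ^ 2 ≤ (∏ i ∈ range k, t i) * ρ 0 ^ 2 := by
    intro k
    induction k with
    | zero => simp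
    | succ k ih =>
      rw [prod_range_succ, mul_comm _ (t k), mul_assoc]
      exact (main k (inv k).1 (inv k).2).2.2.trans (mul_le_mul_of_nonneg_left ih (ht0 k))
  have hsum : ∑ i ∈ range k, t i ≤ 1 := by
    simp only [ht]
    rw [← mul_sum, sum_range_sub']
    linarith [(inv 0).1, hΦ0 k]
  have hP := prod_range_le_of_sum_le_one hk ht0 hsum
  rw [← sq_le_sq₀ (hρ k) (mul_nonneg (by positivity) (hρ 0)), mul_pow]
  have hpow : ((1 / (k : ℝ)) ^ ((k : ℝ) / 2)) ^ 2 = (1 / (k : ℝ)) ^ k := by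
    rw [← Real.rpow_natCast, ← Real.rpow_mul (by positivity), ← Real.rpow_natCast]
    congr 1
    push_cast
    ring
  rw [hpow]
  exact (hprod k).trans (mul_le_mul_of_nonneg_right hP (sq_nonneg _))

lemma isUnit_of_frob_sub_one_lt {B : Mat d} (h : frob (B - 1) < 1) : IsUnit B := by
  rw [← Matrix.mulVec_injective_iff_isUnit]
  intro v w hvw
  set z : E d := WithLp.toLp 2 v - WithLp.toLp 2 w with hz
  have h0 : mApp B z = 0 := by
    rw [hz, mApp_sub, sub_eq_zero]
    simp [mApp, Matrix.toEuclideanCLM_toLp, hvw]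
  have h1 : ‖z‖ ≤ frob (B - 1) * ‖z‖ := by
    have := norm_mApp_le (B - 1) z
    rwa [mApp_sub_left, h0, mApp_one, zero_sub, norm_neg] at this
  have h2 : ‖z‖ = 0 := by nlinarith [norm_nonneg z]
  have h3 := sub_eq_zero.1 (norm_eq_zero.1 h2)
  exact congrArg WithLp.ofLp h3

lemma norm_gradient_sub_sub_le {g : E d → E d} {H : E d → Mat d} {xs : E d} {M R : ℝ} (hM : 0 ≤ M)
    (hd : ∀ x, HasFDerivAt g (Matrix.toEuclideanCLM (𝕜 := ℝ) (H x)) x)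
    (hLip : ∀ x, spec (H x - H xs) ≤ M * ‖x - xs‖) {a b : E d} (ha : ‖a - xs‖ ≤ R)
    (hb : ‖b - xs‖ ≤ R) : ‖g b - g a - mApp (H xs) (b - a)‖ ≤ M * R * ‖b - a‖ := by
  refine (convex_closedBall xs R).norm_image_sub_le_of_norm_hasFDerivWithin_le'
    (fun x _ => (hd x).hasFDerivWithinAt) (fun x hx => ?_)
    (by simpa [dist_eq_norm] using ha) (by simpa [dist_eq_norm] using hb)
  rw [← map_sub]
  refine (hLip x).trans ?_
  rw [Metric.mem_closedBall, dist_eq_norm] at hx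
  gcongr

lemma gradient_eq_zero_of_forall_le {f : E d → ℝ} {v xs : E d} (h : HasGradientAt f v xs)
    (hmin : ∀ x, f xs ≤ f x) : v = 0 := by
  have h0 := IsLocalMin.hasFDerivAt_eq_zero (Filter.Eventually.of_forall hmin) h.hasFDerivAt
  simpa using h0

end DFP

theorem dfp_superlinear_convergence_explicit
    {d : ℕ}
    (f : E d → ℝ) (g : E d → E d) (Hess : E d → Mat d) (xs : E d)
    (μ L M : ℝ) (hμ : 0 < μ) (hμL : μ ≤ L) (hM : 0 < M)
    -- `g` is the gradient of `f`, and `Hess` its Hessian (so `f` is twice differentiable)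
    (hg : ∀ x, HasGradientAt f (g x) x)
    (hHd : ∀ x, HasFDerivAt g (Matrix.toEuclideanCLM (𝕜 := ℝ) (Hess x)) x)
    -- `xs` is the unique minimizer of `f`
    (hmin : ∀ x, f xs ≤ f x)
    (huniq : ∀ x, (∀ y, f x ≤ f y) → x = xs)
    -- Assumption 1: strong convexity and gradient Lipschitz continuity
    (hgl : ∀ x y, μ * ‖x - y‖ ≤ ‖g x - g y‖)
    (hgu : ∀ x y, ‖g x - g y‖ ≤ L * ‖x - y‖)
    (hHl : ∀ x v, μ * ‖v‖ ^ 2 ≤ dot v (mApp (Hess x) v))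
    (hHu : ∀ x v, dot v (mApp (Hess x) v) ≤ L * ‖v‖ ^ 2)
    -- Assumption 2: Hessian Lipschitz continuity toward the optimum
    (hLip : ∀ x, spec (Hess x - Hess xs) ≤ M * ‖x - xs‖)
    -- `sqH` is the positive definite square root `H_*^{1/2}` of `H_* = ∇²f(x_*)`
    (sqH : Mat d) (hsqH : sqH.PosDef) (hsqH2 : sqH * sqH = Hess xs)
    -- the DFP method
    (x : ℕ → E d) (B : ℕ → Mat d)
    (hB0pd : (B 0).PosDef)
    (hxup : ∀ k, x (k+1) = x k - mApp (B k)⁻¹ (g (x k)))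
    (hsne : ∀ k, x (k+1) - x k ≠ 0)
    (hBup : ∀ k, B (k+1) = dfpUpdate (B k) (x (k+1) - x k) (g (x (k+1)) - g (x k)))
    (hx0 : ‖x 0 - xs‖ ≤ μ ^ ((3:ℝ)/2) / (200 * M * Real.sqrt L))
    (hB0 : frob (sqH⁻¹ * B 0 * sqH⁻¹ - 1) ≤ 1/12) :
    ∀ k : ℕ, 1 ≤ k →
      ‖x k - xs‖ ≤ Real.sqrt (L / μ) * (1/(k:ℝ)) ^ ((k:ℝ)/2) * ‖x 0 - xs‖ := by
  have hST : sqHᵀ = sqH := by simpa using hsqH.isHermitian.eq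
  have hSu : IsUnit sqH := hsqH.isUnit
  have hdet : IsUnit sqH.det := (Matrix.isUnit_iff_isUnit_det sqH).1 hSu
  have hS1 : sqH⁻¹ * sqH = 1 := Matrix.nonsing_inv_mul sqH hdet
  have hS2 : sqH * sqH⁻¹ = 1 := Matrix.mul_nonsing_inv sqH hdet
  have hsμ : 0 < √μ := Real.sqrt_pos.2 hμ
  have hL : 0 < L := hμ.trans_le hμL
  have hsL : 0 < √L := Real.sqrt_pos.2 hL
  have hSsq : ∀ v, ‖mApp sqH v‖ ^ 2 = dot v (mApp (Hess xs) v) := fun v => by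
    rw [← dot_self, dot_mApp, hST, ← mApp_mul, hsqH2, dot_comm]
  have hSlow : ∀ v, √μ * ‖v‖ ≤ ‖mApp sqH v‖ := fun v => by
    rw [← sq_le_sq₀ (by positivity) (norm_nonneg _), mul_pow, Real.sq_sqrt hμ.le, hSsq]
    exact hHl xs v
  have hSup : ∀ v, ‖mApp sqH v‖ ≤ √L * ‖v‖ := fun v => by
    rw [← sq_le_sq₀ (norm_nonneg _) (by positivity), mul_pow, Real.sq_sqrt hL.le, hSsq]
    exact hHu xs v
  have hSinv : ∀ v, ‖mApp sqH⁻¹ v‖ ≤ ‖v‖ / √μ := fun v => by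
    have := hSlow (mApp sqH⁻¹ v)
    rw [← mApp_mul, hS2, mApp_one] at this
    rw [le_div_iff₀ hsμ]; linarith
  have hgs : g xs = 0 := gradient_eq_zero_of_forall_le (hg xs) hmin
  set c : ℝ := M / √μ ^ 3 with hc
  have hc0 : 0 < c := by positivity
  have hsm : ∀ (a b : E d) (D : ℝ), ‖mApp sqH (a - xs)‖ ≤ D → ‖mApp sqH (b - xs)‖ ≤ D →
      ‖(mApp sqH⁻¹ (g b) - mApp sqH⁻¹ (g a)) - mApp sqH (b - a)‖
        ≤ c * D * ‖mApp sqH (b - a)‖ := by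
    intro a b D ha hb
    have hball : ∀ z : E d, ‖mApp sqH (z - xs)‖ ≤ D → ‖z - xs‖ ≤ D / √μ := fun z hz => by
      rw [le_div_iff₀ hsμ]; linarith [hSlow (z - xs)]
    have h1 := norm_gradient_sub_sub_le hM.le hHd hLip (hball a ha) (hball b hb)
    have h2 : (mApp sqH⁻¹ (g b) - mApp sqH⁻¹ (g a)) - mApp sqH (b - a)
        = mApp sqH⁻¹ (g b - g a - mApp (Hess xs) (b - a)) := by
      rw [mApp_sub _ (g b - g a), mApp_sub _ (g b), ← mApp_mul _ (Hess xs), ← hsqH2, ← mul_assoc,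
        hS1, one_mul]
    have h3 : ‖b - a‖ ≤ ‖mApp sqH (b - a)‖ / √μ := by
      rw [le_div_iff₀ hsμ]; linarith [hSlow (b - a)]
    have hD : 0 ≤ D := (norm_nonneg _).trans ha
    rw [h2]
    calc _ ≤ M * (D / √μ) * (‖mApp sqH (b - a)‖ / √μ) / √μ :=
          (hSinv _).trans (by gcongr; exact h1.trans (by gcongr))
      _ = _ := by rw [hc]; field_simp
  have hsm0 : ∀ (b : E d) (D : ℝ), ‖mApp sqH (b - xs)‖ ≤ D →
      ‖mApp sqH⁻¹ (g b) - mApp sqH (b - xs)‖ ≤ c * D * ‖mApp sqH (b - xs)‖ := by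
    intro b D hb
    have h0 : mApp sqH (0 : E d) = 0 := by simp [mApp]
    have h0' : mApp sqH⁻¹ (0 : E d) = 0 := by simp [mApp]
    have := hsm xs b D (by rw [sub_self, h0, norm_zero]; exact (norm_nonneg _).trans hb) hb
    rwa [hgs, h0', sub_zero] at this
  have hμ32 : μ ^ ((3 : ℝ) / 2) = √μ ^ 3 := by
    rw [Real.sqrt_eq_rpow, ← Real.rpow_natCast, ← Real.rpow_mul hμ.le]
    norm_num
  have hρ0 : c * ‖mApp sqH (x 0 - xs)‖ ≤ 1 / 200 := by
    rw [hμ32] at hx0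
    calc c * ‖mApp sqH (x 0 - xs)‖ ≤ c * (√L * (√μ ^ 3 / (200 * M * √L))) := by
          gcongr; exact (hSup _).trans (by gcongr)
      _ = 1 / 200 := by rw [hc]; field_simp
  intro k hk
  have key := superlinear_of_step_bounds
    (e := fun k => frob (sqH⁻¹ * B k * sqH⁻¹ - 1)) (ρ := fun k => ‖mApp sqH (x k - xs)‖)
    hc0.le (fun _ => frob_nonneg _) (fun _ => norm_nonneg _) hB0 hρ0 (fun k hek hσk => by
      have hdiff : mApp sqH (x (k + 1) - xs) - mApp sqH (x k - xs)
          = mApp sqH (x (k + 1) - x k) := by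
        rw [← mApp_sub]; congr 1; abel
      have hne : mApp sqH (x (k + 1) - x k) ≠ 0 := by
        rw [← norm_pos_iff]
        exact lt_of_lt_of_le (mul_pos hsμ (norm_pos_iff.2 (hsne k))) (hSlow _)
      have hBu : IsUnit (B k) := by
        have h1 : B k = sqH * (sqH⁻¹ * B k * sqH⁻¹) * sqH := by
          rw [mul_assoc, mul_assoc _ _ sqH, hS1, mul_one, ← mul_assoc, hS2, one_mul]
        rw [h1]
        exact (hSu.mul (isUnit_of_frob_sub_one_lt (by linarith))).mul hSu
      have hBs : mApp (B k) (x (k + 1) - x k) = -g (x k) := by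
        have h1 : x (k + 1) - x k = -mApp (B k)⁻¹ (g (x k)) := by rw [hxup k]; abel
        have h2 : mApp (B k) (-mApp (B k)⁻¹ (g (x k)))
            = -mApp (B k * (B k)⁻¹) (g (x k)) := by simp [mApp]
        rw [h1, h2, Matrix.mul_nonsing_inv _ ((Matrix.isUnit_iff_isUnit_det _).1 hBu), mApp_one]
      have hstep : mApp (sqH⁻¹ * B k * sqH⁻¹) (mApp sqH (x (k + 1) - x k))
          = -mApp sqH⁻¹ (g (x k)) := by
        rw [← mApp_mul, mul_assoc, hS1, mul_one, mApp_mul, hBs]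
        simp [mApp]
      have hBk : sqH⁻¹ * B (k + 1) * sqH⁻¹ = dfpUpdate (sqH⁻¹ * B k * sqH⁻¹)
          (mApp sqH (x (k + 1) - x k)) (mApp sqH⁻¹ (g (x (k + 1))) - mApp sqH⁻¹ (g (x k))) := by
        rw [hBup k, dfpUpdate_conj hST hSu, mApp_sub sqH⁻¹]
      simp only [hBk]
      rw [← hdiff] at hne hstep ⊢
      refine normalized_step hne hek (mul_nonneg hc0.le (norm_nonneg _)) hσk hstep
        (hsm0 _ _ le_rfl) (fun h => hsm0 _ _ h) (fun h => ?_)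
      rw [hdiff]
      exact hsm _ _ _ le_rfl h) hk
  have h1 : ‖x k - xs‖ ≤ ‖mApp sqH (x k - xs)‖ / √μ := by
    rw [le_div_iff₀ hsμ]; linarith [hSlow (x k - xs)]
  calc ‖x k - xs‖ ≤ (1 / (k : ℝ)) ^ ((k : ℝ) / 2) * (√L * ‖x 0 - xs‖) / √μ :=
        h1.trans (by gcongr; exact key.trans (by gcongr; exact hSup _))
    _ = _ := by rw [Real.sqrt_div hL.le]; ring
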